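/- arXiv:2602.19609 — 6 statements merged into one kernel-verified Lean document; each statement's English description precedes it below -/
import Mathlib

section
/- Soundness of rule WELL-J: Assume the four premises of rule WELL-J hold, namely (JW1) for every state q, φ q implies φ_j q for some j with 0 ≤ j ≤ m; (JW2) for every i with 1 ≤ i ≤ m and every transition (q, α, q') ∈ T, if φ_i q then either there exists j with 0 ≤ j ≤ m such that φ_j q' and δ_i q ≻ δ_j q', or else φ_i q' and δ_i q' = δ_i q; (JW3) for every i with 1 ≤ i ≤ m and every transition (q, μ_i, q') ∈ T, if φ_i q then there exists j with 0 ≤ j ≤ m such that φ_j q' and δ_i q ≻ δ_j q'; (JW4) for every i with 1 ≤ i ≤ m and every state q, φ_i q implies that the label μ_i is enabled at q. Then every J-fair run π with computation σ satisfies the response property □(φ → ◇ψ): for every k, if φ(σ k) then there exists i ≥ k with ψ(σ i). -/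
/-- A label `α` is enabled at state `q` if there is an outgoing `α`-transition. -/
def Enabled {Q L : Type*} (T : Q → L → Q → Prop) (α : L) (q : Q) : Prop :=
  ∃ q', T q α q'

/-- A run of an LTS: each step is a transition and consecutive steps are glued. -/
def IsRun {Q L : Type*} (T : Q → L → Q → Prop) (π : ℕ → Q × L × Q) : Prop :=
  (∀ k, T (π k).1 (π k).2.1 (π k).2.2) ∧ (∀ k, (π k).2.2 = (π (k + 1)).1)

/-- A run is `J`-fair: any just label continuously enabled from `k` on is
eventually taken. -/
def FairRun {Q L : Type*} (T : Q → L → Q → Prop) (J : Set L)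
    (π : ℕ → Q × L × Q) : Prop :=
  ∀ α ∈ J, ∀ k, (∀ i ≥ k, Enabled T α (π i).1) → ∃ i ≥ k, (π i).2.1 = α

/-- Soundness of rule WELL-J. -/
theorem wellJ_sound {Q L A : Type*}
    (T : Q → L → Q → Prop) (hTotal : ∀ q, ∃ α q', T q α q')
    (J : Set L) (m : ℕ)
    (φ ψ : Q → Prop) (Φ : ℕ → Q → Prop) (hΦ0 : Φ 0 = ψ)
    (succ : A → A → Prop)
    (htrans : Transitive succ) (hirr : Irreflexive succ)
    (hwf : WellFounded (fun a b => succ b a))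
    (δ : ℕ → Q → A)
    (μ : ℕ → L) (hμJ : ∀ i, 1 ≤ i → i ≤ m → μ i ∈ J)
    (JW1 : ∀ q, φ q → ∃ j, j ≤ m ∧ Φ j q)
    (JW2 : ∀ i, 1 ≤ i → i ≤ m → ∀ q α q', T q α q' → Φ i q →
      (∃ j, j ≤ m ∧ Φ j q' ∧ succ (δ i q) (δ j q')) ∨ (Φ i q' ∧ δ i q' = δ i q))
    (JW3 : ∀ i, 1 ≤ i → i ≤ m → ∀ q q', T q (μ i) q' → Φ i q →
      ∃ j, j ≤ m ∧ Φ j q' ∧ succ (δ i q) (δ j q'))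
    (JW4 : ∀ i, 1 ≤ i → i ≤ m → ∀ q, Φ i q → Enabled T (μ i) q)
    (π : ℕ → Q × L × Q) (hrun : IsRun T π) (hfair : FairRun T J π) :
    ∀ k, φ ((π k).1) → ∃ i ≥ k, ψ ((π i).1) := by
  obtain ⟨hstep, hglue⟩ := hrun
  have key : ∀ a, ∀ k j, j ≤ m → Φ j (π k).1 → δ j (π k).1 = a → ∃ i ≥ k, ψ (π i).1 := by
    intro a
    induction a using hwf.induction with
    | _ a ih =>
      intro k j hj hΦ hδ
      rcases Nat.eq_zero_or_pos j with rfl | hpos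
      · exact ⟨k, le_rfl, hΦ0 ▸ hΦ⟩
      by_cases hdesc : ∃ n ≥ k, ∃ j', j' ≤ m ∧ Φ j' (π n).1 ∧ succ a (δ j' (π n).1)
      · obtain ⟨n, hn, j', hj', hΦ', hlt⟩ := hdesc
        obtain ⟨i, hi, hψ⟩ := ih _ hlt n j' hj' hΦ' rfl
        exact ⟨i, hn.trans hi, hψ⟩
      · have stay : ∀ n ≥ k, Φ j (π n).1 ∧ δ j (π n).1 = a := by
          intro n hn
          induction n, hn using Nat.le_induction with
          | base => exact ⟨hΦ, hδ⟩
          | succ n hn hinv =>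
            have h := JW2 j hpos hj _ _ _ (hstep n) hinv.1
            rw [hglue n, hinv.2] at h
            exact h.resolve_left fun h => hdesc ⟨n + 1, by omega, h⟩
        obtain ⟨n, hn, hlabel⟩ := hfair (μ j) (hμJ j hpos hj) k
          fun n hn => JW4 j hpos hj _ (stay n hn).1
        have h := JW3 j hpos hj _ _ (hlabel ▸ hstep n) (stay n hn).1
        rw [hglue n, (stay n hn).2] at h
        exact absurd ⟨n + 1, by omega, h⟩ hdesc
  intro k hk
  obtain ⟨j, hj, hΦ⟩ := JW1 _ hk
  exact key _ k j hj hΦ rfl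
end

section
/- Soundness of rule WELL-JP (parameterized version of WELL-J): Assume the four parameterized premises hold, namely (JW1) for every state q, φ q implies φ_j[τ] q for some j with 0 ≤ j ≤ m and some parameter τ; (JW2) for every i with 1 ≤ i ≤ m, every parameter τ, and every transition (q, α, q') ∈ T, if φ_i[τ] q then either there exist j with 0 ≤ j ≤ m and a parameter τ' such that φ_j[τ'] q' and δ_i[τ] q ≻ δ_j[τ'] q', or else φ_i[τ] q' and δ_i[τ] q' = δ_i[τ] q; (JW3) for every i with 1 ≤ i ≤ m, every parameter τ, and every transition (q, μ_i[τ], q') ∈ T, if φ_i[τ] q then there exist j with 0 ≤ j ≤ m and a parameter τ' such that φ_j[τ'] q' and δ_i[τ] q ≻ δ_j[τ'] q'; (JW4) for every i with 1 ≤ i ≤ m, every parameter τ, and every state q, φ_i[τ] q implies that μ_i[τ] is enabled at q. Then every J-fair run π with computation σ satisfies the response property □(φ → ◇ψ): for every k, if φ(σ k) then there exists i ≥ k with ψ(σ i). -/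
/-- Soundness of rule WELL-JP (parameterized version of WELL-J).
Here `Φ i τ`, `δ i τ` and `μ i τ` are the parameterized assertions, ranking
functions and helpful labels; by convention `Φ 0 τ = ψ` and `δ 0 τ = δ0`. -/
theorem wellJP_sound {Q L A P : Type*}
    (T : Q → L → Q → Prop) (hTotal : ∀ q, ∃ α q', T q α q')
    (J : Set L) (m : ℕ)
    (φ ψ : Q → Prop)
    (Φ : ℕ → P → Q → Prop) (hΦ0 : ∀ τ : P, Φ 0 τ = ψ)
    (succ : A → A → Prop)
    (htrans : Transitive succ) (hirr : Irreflexive succ)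
    (hwf : WellFounded (fun a b => succ b a))
    (δ : ℕ → P → Q → A) (δ0 : Q → A) (hδ0 : ∀ τ : P, δ 0 τ = δ0)
    (μ : ℕ → P → L) (hμJ : ∀ i, 1 ≤ i → i ≤ m → ∀ τ : P, μ i τ ∈ J)
    (JW1 : ∀ q, φ q → ∃ j, j ≤ m ∧ ∃ τ : P, Φ j τ q)
    (JW2 : ∀ i, 1 ≤ i → i ≤ m → ∀ τ : P, ∀ q α q', T q α q' → Φ i τ q →
      (∃ j, j ≤ m ∧ ∃ τ' : P, Φ j τ' q' ∧ succ (δ i τ q) (δ j τ' q')) ∨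
        (Φ i τ q' ∧ δ i τ q' = δ i τ q))
    (JW3 : ∀ i, 1 ≤ i → i ≤ m → ∀ τ : P, ∀ q q', T q (μ i τ) q' → Φ i τ q →
      ∃ j, j ≤ m ∧ ∃ τ' : P, Φ j τ' q' ∧ succ (δ i τ q) (δ j τ' q'))
    (JW4 : ∀ i, 1 ≤ i → i ≤ m → ∀ τ : P, ∀ q, Φ i τ q → Enabled T (μ i τ) q)
    (π : ℕ → Q × L × Q) (hrun : IsRun T π) (hfair : FairRun T J π) :
    ∀ k, φ ((π k).1) → ∃ i ≥ k, ψ ((π i).1) := by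
  have rank_induction : ∀ a k i, i ≤ m → ∀ τ : P, Φ i τ (π k).1 → δ i τ (π k).1 = a →
      ∃ n ≥ k, ψ (π n).1 := by
    intro a
    induction a using hwf.induction with
    | _ a ih =>
    intro k i him τ hΦ hδ
    rcases Nat.eq_zero_or_pos i with rfl | hi
    · exact ⟨k, le_rfl, hΦ0 τ ▸ hΦ⟩
    by_cases hdrop : ∃ n ≥ k, ∃ j, j ≤ m ∧ ∃ τ' : P,
        Φ j τ' (π n).1 ∧ succ a (δ j τ' (π n).1)
    · obtain ⟨n, hkn, j, hj, τ', hΦj, hsucc⟩ := hdrop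
      obtain ⟨l, hnl, hψ⟩ := ih _ hsucc n j hj τ' hΦj rfl
      exact ⟨l, hkn.trans hnl, hψ⟩
    have stable : ∀ n ≥ k, Φ i τ (π n).1 ∧ δ i τ (π n).1 = a := by
      intro n hn
      induction n, hn using Nat.le_induction with
      | base => exact ⟨hΦ, hδ⟩
      | succ n hn hstep =>
        have h := JW2 i hi him τ _ _ _ (hrun.1 n) hstep.1
        rw [hrun.2 n, hstep.2] at h
        exact h.resolve_left fun h => hdrop ⟨n + 1, Nat.le_succ_of_le hn, h⟩
    obtain ⟨n, hn, hlabel⟩ := hfair (μ i τ) (hμJ i hi him τ) k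
      fun n hn => JW4 i hi him τ _ (stable n hn).1
    have h := JW3 i hi him τ _ _ (hlabel ▸ hrun.1 n) (stable n hn).1
    rw [hrun.2 n, (stable n hn).2] at h
    exact absurd ⟨n + 1, Nat.le_succ_of_le hn, h⟩ hdrop
  intro k hφ
  obtain ⟨j, hj, τ, hΦ⟩ := JW1 _ hφ
  exact rank_induction _ k j hj τ hΦ rfl
end

section
/- Progress lemma for rule WELL-J: Assume premises (JW2), (JW3), and (JW4) of rule WELL-J hold, namely (JW2) for every i with 1 ≤ i ≤ m and every transition (q, α, q') ∈ T, if φ_i q then either there exists j with 0 ≤ j ≤ m such that φ_j q' and δ_i q ≻ δ_j q', or else φ_i q' and δ_i q' = δ_i q; (JW3) for every i with 1 ≤ i ≤ m and every transition (q, μ_i, q') ∈ T, if φ_i q then there exists j with 0 ≤ j ≤ m such that φ_j q' and δ_i q ≻ δ_j q'; (JW4) for every i with 1 ≤ i ≤ m and every state q, φ_i q implies that μ_i is enabled at q. Then for every J-fair run π with computation σ, every position k, and every i with 1 ≤ i ≤ m, if φ_i(σ k) holds, then there exist a position k' > k and an index j with 0 ≤ j ≤ m such that φ_j(σ k') holds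 and δ_i(σ k) ≻ δ_j(σ k'). -/
/-- Progress lemma for rule WELL-J: under premises JW2, JW3 and JW4, from any
position of a fair run in which an intermediate assertion `Φ i` (1 ≤ i ≤ m)
holds, a later position is reached at which some `Φ j` holds with a strictly
smaller rank. -/
theorem wellJ_progress {Q L A : Type*}
    (T : Q → L → Q → Prop) (hTotal : ∀ q, ∃ α q', T q α q')
    (J : Set L) (m : ℕ)
    (φ ψ : Q → Prop) (Φ : ℕ → Q → Prop) (hΦ0 : Φ 0 = ψ)
    (succ : A → A → Prop)
    (htrans : Transitive succ) (hirr : Irreflexive succ)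
    (hwf : WellFounded (fun a b => succ b a))
    (δ : ℕ → Q → A)
    (μ : ℕ → L) (hμJ : ∀ i, 1 ≤ i → i ≤ m → μ i ∈ J)
    (JW2 : ∀ i, 1 ≤ i → i ≤ m → ∀ q α q', T q α q' → Φ i q →
      (∃ j, j ≤ m ∧ Φ j q' ∧ succ (δ i q) (δ j q')) ∨ (Φ i q' ∧ δ i q' = δ i q))
    (JW3 : ∀ i, 1 ≤ i → i ≤ m → ∀ q q', T q (μ i) q' → Φ i q →
      ∃ j, j ≤ m ∧ Φ j q' ∧ succ (δ i q) (δ j q'))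
    (JW4 : ∀ i, 1 ≤ i → i ≤ m → ∀ q, Φ i q → Enabled T (μ i) q)
    (π : ℕ → Q × L × Q) (hrun : IsRun T π) (hfair : FairRun T J π) :
    ∀ k, ∀ i, 1 ≤ i → i ≤ m → Φ i ((π k).1) →
      ∃ k', k' > k ∧ ∃ j, j ≤ m ∧ Φ j ((π k').1) ∧
        succ (δ i ((π k).1)) (δ j ((π k').1)) := by
  intro k i hi him hk
  by_contra! hno
  have hstay : ∀ n, Φ i (π (k + n)).1 ∧ δ i (π (k + n)).1 = δ i (π k).1 := by
    intro n
    induction n with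
    | zero => exact ⟨hk, rfl⟩
    | succ n ih =>
      obtain ⟨hΦ, hδ⟩ := ih
      have hstep := JW2 i hi him _ _ _ (hrun.1 (k + n)) hΦ
      rw [hrun.2 (k + n), hδ] at hstep
      rcases hstep with ⟨j, hj, hΦj, hlt⟩ | hsame
      · exact absurd hlt (hno (k + n + 1) (by omega) j hj hΦj)
      · exact hsame
  have hstay' : ∀ l ≥ k, Φ i (π l).1 ∧ δ i (π l).1 = δ i (π k).1 := by
    intro l hl
    obtain ⟨n, rfl⟩ := Nat.exists_eq_add_of_le hl
    exact hstay n
  obtain ⟨l, hl, hlabel⟩ := hfair (μ i) (hμJ i hi him) k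
    fun l hl => JW4 i hi him _ (hstay' l hl).1
  have htaken := hrun.1 l
  rw [hlabel, hrun.2 l] at htaken
  obtain ⟨j, hj, hΦj, hlt⟩ := JW3 i hi him _ _ htaken (hstay' l hl).1
  rw [(hstay' l hl).2] at hlt
  exact hno (l + 1) (by omega) j hj hΦj hlt
end

section
/- Thread views point to messages in Release–Acquire: In every reachable RA state (M, ν), for every thread τ and every location x there exists a message m ∈ M with m.loc = x and m.ts = ν τ x. -/
/-- A message in the Release–Acquire memory model: location, value, timestamp,
writing thread and attached view. -/
structure Message (Loc Tid : Type*) where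
  loc : Loc
  val : ℕ
  ts : ℕ
  tid : Tid
  view : Loc → ℕ

/-- An RA state: a set of messages together with a view per thread. -/
abbrev RAState (Loc Tid : Type*) := Set (Message Loc Tid) × (Tid → Loc → ℕ)

/-- The transitions of the Release–Acquire memory model: read, write,
read-modify-write and propagate. -/
inductive RAStep {Loc Tid : Type*} [DecidableEq Loc] [DecidableEq Tid] :
    RAState Loc Tid → RAState Loc Tid → Prop
  | read (M : Set (Message Loc Tid)) (ν : Tid → Loc → ℕ) (τ : Tid) (x : Loc)
      (m : Message Loc Tid) (hm : m ∈ M) (hloc : m.loc = x)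
      (hts : m.ts = ν τ x) :
      RAStep (M, ν) (M, ν)
  | write (M : Set (Message Loc Tid)) (ν : Tid → Loc → ℕ) (τ : Tid) (x : Loc)
      (v t : ℕ) (hlt : ν τ x < t)
      (hfresh : ∀ m ∈ M, m.loc = x → m.ts ≠ t) :
      RAStep (M, ν)
        (insert ⟨x, v, t, τ, Function.update (ν τ) x t⟩ M,
          Function.update ν τ (Function.update (ν τ) x t))
  | rmw (M : Set (Message Loc Tid)) (ν : Tid → Loc → ℕ) (τ : Tid) (x : Loc)
      (v : ℕ) (mr : Message Loc Tid) (hm : mr ∈ M) (hloc : mr.loc = x)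
      (hts : mr.ts = ν τ x)
      (hfresh : ∀ m ∈ M, m.loc = x → m.ts ≠ ν τ x + 1) :
      RAStep (M, ν)
        (insert ⟨x, v, ν τ x + 1, τ, Function.update (ν τ) x (ν τ x + 1)⟩ M,
          Function.update ν τ (Function.update (ν τ) x (ν τ x + 1)))
  | prop (M : Set (Message Loc Tid)) (ν : Tid → Loc → ℕ) (τ : Tid)
      (m : Message Loc Tid) (hm : m ∈ M) (hlt : ν τ m.loc < m.ts) :
      RAStep (M, ν) (M, Function.update ν τ (fun y => max (ν τ y) (m.view y)))

/-- The initial RA state: one message per location with value 0, timestamp 0,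
written by the initial thread `t0`; all thread views are zero. -/
def RAInit (Loc Tid : Type*) (t0 : Tid) : RAState Loc Tid :=
  ({ m | ∃ x : Loc, m = ⟨x, 0, 0, t0, fun _ => 0⟩ }, fun _ _ => 0)

/-- A state is reachable if it is obtained from the initial state by finitely
many RA transitions. -/
def RAReachable {Loc Tid : Type*} [DecidableEq Loc] [DecidableEq Tid]
    (t0 : Tid) (q : RAState Loc Tid) : Prop :=
  Relation.ReflTransGen RAStep (RAInit Loc Tid t0) q

/-- A view points to messages of `M` if its timestamp at every location is the timestamp
of some message of `M` at that location. -/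
def ViewPointsTo {Loc Tid : Type*} (M : Set (Message Loc Tid)) (V : Loc → ℕ) : Prop :=
  ∀ x, ∃ m ∈ M, m.loc = x ∧ m.ts = V x

theorem ViewPointsTo.mono {Loc Tid : Type*} {M N : Set (Message Loc Tid)} {V : Loc → ℕ}
    (h : ViewPointsTo M V) (hMN : M ⊆ N) : ViewPointsTo N V := fun x =>
  let ⟨m, hm, hx⟩ := h x
  ⟨m, hMN hm, hx⟩

theorem ViewPointsTo.sup {Loc Tid : Type*} {M : Set (Message Loc Tid)} {V W : Loc → ℕ}
    (hV : ViewPointsTo M V) (hW : ViewPointsTo M W) :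
    ViewPointsTo M (fun x => max (V x) (W x)) := by
  intro x
  rcases max_choice (V x) (W x) with h | h
  · simpa only [h] using hV x
  · simpa only [h] using hW x

theorem ViewPointsTo.insert_update {Loc Tid : Type*} [DecidableEq Loc]
    {M : Set (Message Loc Tid)} {V : Loc → ℕ} (h : ViewPointsTo M V) (m : Message Loc Tid) :
    ViewPointsTo (insert m M) (Function.update V m.loc m.ts) := by
  intro y
  rcases eq_or_ne y m.loc with rfl | hy
  · exact ⟨m, Set.mem_insert _ _, rfl, by simp⟩
  · simpa only [Function.update_of_ne hy] using h.mono (Set.subset_insert m M) y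

/-- All thread views and all message views of the state point to messages of the state. -/
def RAViewsPointTo {Loc Tid : Type*} (q : RAState Loc Tid) : Prop :=
  (∀ τ, ViewPointsTo q.1 (q.2 τ)) ∧ ∀ m ∈ q.1, ViewPointsTo q.1 m.view

theorem RAViewsPointTo.raInit {Loc Tid : Type*} (t0 : Tid) :
    RAViewsPointTo (RAInit Loc Tid t0) := by
  have h : ViewPointsTo (RAInit Loc Tid t0).1 (fun _ => 0) := fun x =>
    ⟨⟨x, 0, 0, t0, fun _ => 0⟩, ⟨x, rfl⟩, rfl, rfl⟩
  refine ⟨fun _ => h, ?_⟩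
  rintro _ ⟨x, rfl⟩
  exact h

theorem RAViewsPointTo.write {Loc Tid : Type*} [DecidableEq Loc] [DecidableEq Tid]
    {M : Set (Message Loc Tid)} {ν : Tid → Loc → ℕ} (h : RAViewsPointTo (M, ν))
    (τ : Tid) (x : Loc) (v t : ℕ) :
    RAViewsPointTo (insert ⟨x, v, t, τ, Function.update (ν τ) x t⟩ M,
      Function.update ν τ (Function.update (ν τ) x t)) := by
  have hnew := (h.1 τ).insert_update ⟨x, v, t, τ, Function.update (ν τ) x t⟩
  have hsub := Set.subset_insert (⟨x, v, t, τ, Function.update (ν τ) x t⟩ : Message Loc Tid) M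
  refine ⟨fun σ => ?_, ?_⟩
  · rcases eq_or_ne σ τ with rfl | hσ
    · simpa only [Function.update_self] using hnew
    · simpa only [Function.update_of_ne hσ] using (h.1 σ).mono hsub
  · rintro m (rfl | hm)
    · exact hnew
    · exact (h.2 m hm).mono hsub

theorem RAViewsPointTo.step {Loc Tid : Type*} [DecidableEq Loc] [DecidableEq Tid]
    {q q' : RAState Loc Tid} (h : RAViewsPointTo q) (hstep : RAStep q q') :
    RAViewsPointTo q' := by
  cases hstep with
  | read => exact h
  | write M ν τ x v t => exact h.write τ x v t
  | rmw M ν τ x v => exact h.write τ x v (ν τ x + 1)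
  | prop M ν τ m hm =>
    refine ⟨fun σ => ?_, h.2⟩
    rcases eq_or_ne σ τ with rfl | hσ
    · simpa only [Function.update_self] using (h.1 σ).sup (h.2 m hm)
    · simpa only [Function.update_of_ne hσ] using h.1 σ

/-- Thread views point to messages in Release–Acquire: in every reachable RA
state, every thread's view at every location is the timestamp of some message
at that location. -/
theorem RA_view_points_to_message {Loc Tid : Type*} [DecidableEq Loc] [DecidableEq Tid]
    (t0 : Tid) (q : RAState Loc Tid) (hreach : RAReachable t0 q) :
    ∀ (τ : Tid) (x : Loc), ∃ m ∈ q.1, m.loc = x ∧ m.ts = q.2 τ x := by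
  have h : RAViewsPointTo q := by
    induction hreach with
    | refl => exact RAViewsPointTo.raInit t0
    | tail _ hstep ih => exact ih.step hstep
  exact h.1
end

section
/- Message views point to messages in Release–Acquire: In every reachable RA state (M, ν), for every message m ∈ M and every location x there exists a message m' ∈ M with m'.loc = x and m'.ts = m.view x. -/
namespace ViewPointsTo

variable {Loc Tid : Type*} {M N : Set (Message Loc Tid)} {V W : Loc → ℕ}

theorem mono_s7 (h : ViewPointsTo M V) (hMN : M ⊆ N) : ViewPointsTo N V := fun x =>
  let ⟨m, hm, hx⟩ := h x
  ⟨m, hMN hm, hx⟩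

theorem sup_s7 (hV : ViewPointsTo M V) (hW : ViewPointsTo M W) :
    ViewPointsTo M (fun y => max (V y) (W y)) := fun x => by
  rcases max_choice (V x) (W x) with h | h
  · simpa only [h] using hV x
  · simpa only [h] using hW x

theorem update_insert [DecidableEq Loc] (h : ViewPointsTo M V) (m : Message Loc Tid) :
    ViewPointsTo (insert m M) (Function.update V m.loc m.ts) := fun x => by
  by_cases hx : x = m.loc
  · subst hx
    exact ⟨m, Set.mem_insert _ _, rfl, by simp⟩
  · simpa only [Function.update_of_ne hx] using h.mono_s7 (Set.subset_insert m M) x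

end ViewPointsTo

/-- All thread views and all message views of the state point to messages. -/
def RAState.ViewsPointToMessages {Loc Tid : Type*} (q : RAState Loc Tid) : Prop :=
  (∀ τ, ViewPointsTo q.1 (q.2 τ)) ∧ ∀ m ∈ q.1, ViewPointsTo q.1 m.view

namespace RAState.ViewsPointToMessages

variable {Loc Tid : Type*}

theorem raInit (t0 : Tid) : ViewsPointToMessages (RAInit Loc Tid t0) := by
  have h : ViewPointsTo (RAInit Loc Tid t0).1 (fun _ => 0) :=
    fun x => ⟨⟨x, 0, 0, t0, fun _ => 0⟩, ⟨x, rfl⟩, rfl, rfl⟩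
  refine ⟨fun _ => h, ?_⟩
  rintro m ⟨x, rfl⟩
  exact h

theorem update_view [DecidableEq Tid] {M : Set (Message Loc Tid)} {ν : Tid → Loc → ℕ}
    (h : ViewsPointToMessages (M, ν)) (τ : Tid) {V : Loc → ℕ} (hV : ViewPointsTo M V) :
    ViewsPointToMessages (M, Function.update ν τ V) :=
  ⟨Function.forall_update_iff ν (fun _ W => ViewPointsTo M W) |>.2 ⟨hV, fun σ _ => h.1 σ⟩, h.2⟩

theorem insert_message {M : Set (Message Loc Tid)} {ν : Tid → Loc → ℕ}
    (h : ViewsPointToMessages (M, ν)) {m : Message Loc Tid}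
    (hm : ViewPointsTo (insert m M) m.view) : ViewsPointToMessages (insert m M, ν) :=
  ⟨fun τ => (h.1 τ).mono_s7 (Set.subset_insert m M),
    Set.forall_mem_insert.2 ⟨hm, fun n hn => (h.2 n hn).mono_s7 (Set.subset_insert m M)⟩⟩

variable [DecidableEq Loc] [DecidableEq Tid]

theorem write {M : Set (Message Loc Tid)} {ν : Tid → Loc → ℕ}
    (h : ViewsPointToMessages (M, ν)) (τ : Tid) (x : Loc) (v t : ℕ) :
    ViewsPointToMessages (insert ⟨x, v, t, τ, Function.update (ν τ) x t⟩ M,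
      Function.update ν τ (Function.update (ν τ) x t)) :=
  have hV := (h.1 τ).update_insert ⟨x, v, t, τ, Function.update (ν τ) x t⟩
  (h.insert_message hV).update_view τ hV

theorem step {q q' : RAState Loc Tid} (h : ViewsPointToMessages q) (hq : RAStep q q') :
    ViewsPointToMessages q' := by
  cases hq with
  | read => exact h
  | write M ν τ x v t => exact h.write τ x v t
  | rmw M ν τ x v => exact h.write τ x v _
  | prop M ν τ m hm => exact h.update_view τ ((h.1 τ).sup_s7 (h.2 m hm))

theorem of_reachable {t0 : Tid} {q : RAState Loc Tid} (hq : RAReachable t0 q) :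
    ViewsPointToMessages q := by
  induction hq with
  | refl => exact raInit t0
  | tail _ hs ih => exact ih.step hs

end RAState.ViewsPointToMessages

/-- Message views point to messages in Release–Acquire: in every reachable RA
state, the view attached to any message points, at every location, to the
timestamp of some message at that location. -/
theorem RA_message_view_points_to_message {Loc Tid : Type*} [DecidableEq Loc] [DecidableEq Tid]
    (t0 : Tid) (q : RAState Loc Tid) (hreach : RAReachable t0 q) :
    ∀ m ∈ q.1, ∀ x : Loc, ∃ m' ∈ q.1, m'.loc = x ∧ m'.ts = m.view x :=
  (RAState.ViewsPointToMessages.of_reachable hreach).2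
end

section
/- Strict view advancement of propagate in Release–Acquire: If (M, ν) is a reachable RA state and a propagate transition via message m ∈ M and thread τ leads to the state (M, ν'), then ν τ (m.loc) < ν' τ (m.loc); that is, every propagate step strictly advances the propagating thread's view at the message's location. -/
/-- In a reachable RA state, the view of every message agrees with its timestamp
at its own location. -/
theorem RAReachable.view_loc_eq_ts {Loc Tid : Type*} [DecidableEq Loc] [DecidableEq Tid]
    {t0 : Tid} {q : RAState Loc Tid} (hreach : RAReachable t0 q) :
    ∀ m ∈ q.1, m.view m.loc = m.ts := by
  unfold RAReachable at hreach
  induction hreach with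
  | refl =>
    rintro m ⟨x, rfl⟩
    rfl
  | tail _ hstep ih =>
    cases hstep with
    | read => exact ih
    | prop => exact ih
    | write | rmw =>
      rintro m (rfl | hm)
      · simp
      · exact ih m hm

/-- Strict view advancement of propagate in Release–Acquire: from a reachable
RA state, a propagate transition via message `m` and thread `τ` strictly
advances `τ`'s view at `m`'s location. -/
theorem RA_propagate_strict_advance {Loc Tid : Type*} [DecidableEq Loc] [DecidableEq Tid]
    (t0 : Tid) (M : Set (Message Loc Tid)) (ν : Tid → Loc → ℕ)
    (hreach : RAReachable t0 (M, ν))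
    (m : Message Loc Tid) (τ : Tid) (hm : m ∈ M) (hlt : ν τ m.loc < m.ts)
    (ν' : Tid → Loc → ℕ)
    (hν' : ν' = Function.update ν τ (fun y => max (ν τ y) (m.view y))) :
    ν τ m.loc < ν' τ m.loc := by
  rw [hν', Function.update_self, hreach.view_loc_eq_ts m hm]
  exact lt_max_of_lt_right hlt
end
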